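/- (Theorem 3.) Let d ≥ 2, let w : Fin d → ℝ with all w i ≠ 0 and W = ∏ i, w i, and let δ, η ∈ ℝ satisfy 0 < δ < 1/2, |η| ≤ δ, and |W − 1| < δ. Define the adaptive learning rate λ = (1/2)·(2/3)⁵·(1/(∑ i, 1/(w i)²)) and the noise-augmented gradient descent step w' i = w i − 2λ·(1 + η)·(W·(1 + η) − 1)·(W/(w i)). Then for any indices i ≠ j, the factor k = 1 − 4λ²·(1 + η)⁴·(W − 1/(1 + η))²·W²/((w i)·(w j))² satisfies 0 < k ≤ 1, and consequently the layer imbalance monotonically decreases: |(w' i)² − (w' j)²| ≤ |(w i)² − (w j)²|, with the sign of (w' i)² − (w' j)² equal to that of (w i)² − (w j)². -/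

import Mathlib

/-- A sum of inverse squares bounds the product of any two entries from below. -/
theorem two_le_sum_inv_sq_mul_abs {ι : Type*} [Fintype ι] (w : ι → ℝ)
    (hw : ∀ i, w i ≠ 0) {i j : ι} (hij : i ≠ j) :
    2 ≤ (∑ l, 1 / (w l) ^ 2) * |w i * w j| := by
  classical
  have hpair : 1 / (w i) ^ 2 + 1 / (w j) ^ 2 ≤ ∑ l, 1 / (w l) ^ 2 := by
    rw [← Finset.sum_pair (f := fun l => 1 / (w l) ^ 2) hij]
    exact Finset.sum_le_sum_of_subset_of_nonneg (Finset.subset_univ _)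
      fun l _ _ => by positivity
  have hi : 0 < |w i| := abs_pos.2 (hw i)
  have hj : 0 < |w j| := abs_pos.2 (hw j)
  refine le_trans ?_ (mul_le_mul_of_nonneg_right hpair (abs_nonneg _))
  rw [abs_mul, ← sq_abs (w i), ← sq_abs (w j), div_add_div _ _ (by positivity) (by positivity),
    div_mul_eq_mul_div, le_div_iff₀ (by positivity)]
  nlinarith [mul_nonneg (mul_pos hi hj).le (sq_nonneg (|w i| - |w j|))]

/-- The step `x ↦ x - c / x` rescales a difference of squares. -/
theorem sq_sub_div_sub_sq_sub_div {a b : ℝ} (ha : a ≠ 0) (hb : b ≠ 0) (c : ℝ) :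
    (a - c / a) ^ 2 - (b - c / b) ^ 2 = (1 - c ^ 2 / (a * b) ^ 2) * (a ^ 2 - b ^ 2) := by
  field_simp
  ring

theorem sign_mul_of_pos {k : ℝ} (hk : 0 < k) (x : ℝ) : Real.sign (k * x) = Real.sign x := by
  rcases lt_trichotomy x 0 with hx | rfl | hx
  · rw [Real.sign_of_neg hx, Real.sign_of_neg (mul_neg_of_pos_of_neg hk hx)]
  · rw [mul_zero]
  · rw [Real.sign_of_pos hx, Real.sign_of_pos (mul_pos hk hx)]

/-- Near a fit, the gradient factor of an augmented step is bounded. -/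
theorem abs_augmented_gradient_le {x W : ℝ} (hx : 1 / 2 ≤ x) (hx' : x ≤ 3 / 2)
    (hW : 1 / 2 ≤ W) (hW' : W ≤ 3 / 2) : |2 * x * (W * x - 1) * W| ≤ 45 / 8 := by
  have hWx : |W * x - 1| ≤ 5 / 4 := by
    rw [abs_le]
    constructor <;> nlinarith
  rw [abs_mul, abs_mul, abs_of_nonneg (by linarith : 0 ≤ 2 * x),
    abs_of_nonneg (by linarith : 0 ≤ W)]
  calc 2 * x * |W * x - 1| * W ≤ 2 * (3 / 2) * (5 / 4) * (3 / 2) := by gcongr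
    _ = 45 / 8 := by norm_num

/-- (Theorem 3.) For one noise-augmented gradient descent step on the deep
linear network with `0 < δ < 1/2`, `|η| ≤ δ`, `|W − 1| < δ`, and adaptive
learning rate `λ = (1/2)(2/3)⁵/(∑ i, 1/(w i)²)`, the contraction factor
`k = 1 − 4λ²(1 + η)⁴(W − 1/(1 + η))²W²/((w i)(w j))²` satisfies `0 < k ≤ 1`;
hence the layer imbalance monotonically decreases and keeps its sign. -/
theorem noise_adaptive_lr_imbalance_decreases
    (d : ℕ) (hd : 2 ≤ d) (w : Fin d → ℝ) (hw : ∀ i, w i ≠ 0)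
    (delta eta : ℝ) (hdelta : 0 < delta) (hdelta' : delta < 1 / 2)
    (heta : |eta| ≤ delta) (hW : |(∏ i, w i) - 1| < delta)
    (lam : ℝ) (hlam : lam = (1 / 2) * (2 / 3) ^ 5 * (1 / ∑ i, 1 / (w i) ^ 2))
    (w' : Fin d → ℝ)
    (hw' : ∀ i, w' i = w i -
      2 * lam * (1 + eta) * ((∏ l, w l) * (1 + eta) - 1) * ((∏ l, w l) / w i))
    (i j : Fin d) (hij : i ≠ j) :
    (0 < 1 - 4 * lam ^ 2 * (1 + eta) ^ 4 * ((∏ l, w l) - 1 / (1 + eta)) ^ 2 *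
        (∏ l, w l) ^ 2 / (w i * w j) ^ 2 ∧
      1 - 4 * lam ^ 2 * (1 + eta) ^ 4 * ((∏ l, w l) - 1 / (1 + eta)) ^ 2 *
        (∏ l, w l) ^ 2 / (w i * w j) ^ 2 ≤ 1) ∧
    |(w' i) ^ 2 - (w' j) ^ 2| ≤ |(w i) ^ 2 - (w j) ^ 2| ∧
    Real.sign ((w' i) ^ 2 - (w' j) ^ 2) = Real.sign ((w i) ^ 2 - (w j) ^ 2) := by
  obtain ⟨hx, hx'⟩ := abs_le.1 heta
  obtain ⟨hV, hV'⟩ := abs_lt.1 hW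
  set W := ∏ l, w l
  set S := ∑ l, 1 / (w l) ^ 2
  have hx0 : 1 + eta ≠ 0 := by linarith
  have hm : 0 < |w i * w j| := abs_pos.2 (mul_ne_zero (hw i) (hw j))
  have hS := two_le_sum_inv_sq_mul_abs w hw hij
  have hSpos : 0 < S := pos_of_mul_pos_left (by linarith) hm.le
  have hlam0 : 0 < lam := by rw [hlam]; positivity
  have hlamS : lam * S = 16 / 243 := by
    rw [hlam]
    field_simp
    norm_num
  have hlam_le : lam ≤ 8 / 243 * |w i * w j| := by nlinarith
  obtain ⟨c, hc⟩ : ∃ c, c = lam * (2 * (1 + eta) * (W * (1 + eta) - 1) * W) := ⟨_, rfl⟩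
  have hc_lt : |c| < |w i * w j| := by
    have hg := abs_augmented_gradient_le (x := 1 + eta) (W := W)
      (by linarith) (by linarith) (by linarith) (by linarith)
    rw [hc, abs_mul, abs_of_pos hlam0]
    nlinarith
  have hk : 4 * lam ^ 2 * (1 + eta) ^ 4 * (W - 1 / (1 + eta)) ^ 2 * W ^ 2 / (w i * w j) ^ 2
      = c ^ 2 / (w i * w j) ^ 2 := by
    rw [hc]
    congr 1
    field_simp
    ring
  have hstep : ∀ l, w' l = w l - c / w l := fun l => by
    rw [hw', hc]
    ring
  have hlt : c ^ 2 / (w i * w j) ^ 2 < 1 :=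
    (div_lt_one (sq_pos_of_ne_zero (mul_ne_zero (hw i) (hw j)))).2 (sq_lt_sq.2 hc_lt)
  have hnonneg : 0 ≤ c ^ 2 / (w i * w j) ^ 2 := by positivity
  have hkpos : 0 < 1 - c ^ 2 / (w i * w j) ^ 2 := sub_pos.2 hlt
  rw [hk, hstep i, hstep j, sq_sub_div_sub_sq_sub_div (hw i) (hw j)]
  refine ⟨⟨hkpos, sub_le_self _ hnonneg⟩, ?_, sign_mul_of_pos hkpos _⟩
  rw [abs_mul, abs_of_pos hkpos]
  exact mul_le_of_le_one_left (abs_nonneg _) (sub_le_self _ hnonneg)
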